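/- Let P be a posterior-deterministic POMDP, f an SEC of P, and b an initial belief with S = supp(b) ∈ dom f. Then, with respect to the probability measure P_b^{unif_f}, for every pair of (f,S)-distinguishable states q, q' ∈ S, almost every observable run distinguishes q and q' infinitely often. -/

import Mathlib

open scoped ENNReal BigOperators Classical
open Filter Topology

/-- A partially observable Markov decision process with finite state space `Q`,
finite action space `A` and finite observation space `O`.  `tr q a o q'` is the
probability `T(o, q' | q, a)` of receiving observation `o` and moving to state `q'`
when taking action `a` in state `q`. -/
structure POMDP (Q A O : Type) [Fintype Q] [Fintype A] [Fintype O] where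
  tr : Q → A → O → Q → ℝ≥0∞
  tr_sum_one : ∀ q a, (∑ o : O, ∑ q' : Q, tr q a o q') = 1

/-- An (observation-based) strategy: to each observable history it assigns a
probability distribution on actions. -/
structure Strategy (A O : Type) [Fintype A] where
  act : List (A × O) → A → ℝ≥0∞
  act_sum_one : ∀ h, (∑ a : A, act h a) = 1

/-- Support of a (sub-)belief. -/
noncomputable def beliefSupp {Q : Type} [Fintype Q] (b : Q → ℝ≥0∞) : Finset Q :=
  Finset.univ.filter fun q => b q ≠ 0

/-- Dirac belief at a state. -/
noncomputable def dirac {Q : Type} (q : Q) : Q → ℝ≥0∞ := fun q' => if q' = q then 1 else 0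

/-- Restriction of a (sub-)belief to a set of states. -/
noncomputable def restrictBel {Q : Type} (b : Q → ℝ≥0∞) (C : Finset Q) : Q → ℝ≥0∞ :=
  fun q => if q ∈ C then b q else 0

/-- The sequence of states visited by a history. -/
def statesOf {Q A O : Type} (q0 : Q) (l : List (A × O × Q)) : List Q :=
  q0 :: l.map fun x => x.2.2

/-- The observable projection of a history. -/
def obsOf {Q A O : Type} (l : List (A × O × Q)) : List (A × O) :=
  l.map fun x => (x.1, x.2.1)

/-- A history hits the target set `Tset` for the first time at its last state. -/
def FirstHit {Q A O : Type} (Tset : Set Q) (q0 : Q) (l : List (A × O × Q)) : Prop :=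
  (∃ q ∈ Tset, (statesOf q0 l).getLast? = some q) ∧
    ∀ q' ∈ (statesOf q0 l).dropLast, q' ∉ Tset

/-- The prefix of length `n` of an observable run. -/
def runPrefix {A O : Type} (ρ : ℕ → A × O) (n : ℕ) : List (A × O) :=
  List.ofFn fun i : Fin n => ρ i

namespace POMDP

variable {Q A O : Type} [Fintype Q] [Fintype A] [Fintype O]

/-- Marginal probability `T(o | q, a)` of receiving observation `o`. -/
noncomputable def trO (P : POMDP Q A O) (q : Q) (a : A) (o : O) : ℝ≥0∞ := ∑ q' : Q, P.tr q a o q'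

/-- A POMDP is posterior-deterministic if for every `(q, a, o)` there is at most one
successor state with positive probability. -/
def PostDet (P : POMDP Q A O) : Prop :=
  ∀ q a o q₁ q₂, P.tr q a o q₁ ≠ 0 → P.tr q a o q₂ ≠ 0 → q₁ = q₂

/-- The set of possible successors of `q` under action `a` and observation `o`
(in a posterior-deterministic POMDP, at most a singleton: `δ(q,a,o)`). -/
noncomputable def succs (P : POMDP Q A O) (q : Q) (a : A) (o : O) : Finset Q :=
  Finset.univ.filter fun q' => P.tr q a o q' ≠ 0

/-- `δ(S, a, o)` on sets of states. -/
noncomputable def stepSet (P : POMDP Q A O) (S : Finset Q) (a : A) (o : O) : Finset Q :=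
  S.biUnion fun q => P.succs q a o

/-- `δ*(S, h)` on sets of states along an observable history. -/
noncomputable def stepSetStar (P : POMDP Q A O) : Finset Q → List (A × O) → Finset Q
  | S, [] => S
  | S, (a, o) :: h => P.stepSetStar (P.stepSet S a o) h

/-- `T(o | b, a)`, the probability of observing `o` from (sub-)belief `b` after action `a`. -/
noncomputable def trOBel (P : POMDP Q A O) (b : Q → ℝ≥0∞) (a : A) (o : O) : ℝ≥0∞ :=
  ∑ q : Q, b q * P.trO q a o

/-- Belief update `b_{a,o}`. -/
noncomputable def belStep (P : POMDP Q A O) (b : Q → ℝ≥0∞) (a : A) (o : O) : Q → ℝ≥0∞ :=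
  fun q => (∑ q' : Q, b q' * P.tr q' a o q) / P.trOBel b a o

/-- Iterated belief update `δ*(b, h)` along an observable history. -/
noncomputable def belStepStar (P : POMDP Q A O) : (Q → ℝ≥0∞) → List (A × O) → Q → ℝ≥0∞
  | b, [] => b
  | b, (a, o) :: h => P.belStepStar (P.belStep b a o) h

/-- Probability of the continuation of a history under a strategy:
`runProbAux σ hist q l` is the probability, starting from state `q` after the
observable history `hist`, that the next steps are exactly `l`. -/
noncomputable def runProbAux (P : POMDP Q A O) (σ : Strategy A O) :
    List (A × O) → Q → List (A × O × Q) → ℝ≥0∞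
  | _, _, [] => 1
  | hist, q, (a, o, q') :: rest =>
      σ.act hist a * P.tr q a o q' * P.runProbAux σ (hist ++ [(a, o)]) q' rest

/-- Probability `P_b^σ(Cyl(q0, l))` of the cylinder of a history. -/
noncomputable def histProb (P : POMDP Q A O) (b : Q → ℝ≥0∞) (σ : Strategy A O)
    (q0 : Q) (l : List (A × O × Q)) : ℝ≥0∞ :=
  b q0 * P.runProbAux σ [] q0 l

/-- Probability `P_b^σ(Reach(Tset))` of eventually visiting the target set:
the sum of cylinder probabilities over all histories hitting `Tset` for the first
time at their last state. -/
noncomputable def reachProb (P : POMDP Q A O) (Tset : Set Q) (b : Q → ℝ≥0∞)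
    (σ : Strategy A O) : ℝ≥0∞ :=
  ∑' p : Q × List (A × O × Q), if FirstHit Tset p.1 p.2 then P.histProb b σ p.1 p.2 else 0

/-- The reachability value `Val(b) = sup_σ P_b^σ(Reach(Tset))`. -/
noncomputable def val (P : POMDP Q A O) (Tset : Set Q) (b : Q → ℝ≥0∞) : ℝ≥0∞ :=
  ⨆ σ : Strategy A O, P.reachProb Tset b σ

/-- `Val(b, a) = Σ_o T(o | b, a) · Val(b_{a,o})`. -/
noncomputable def valAct (P : POMDP Q A O) (Tset : Set Q) (b : Q → ℝ≥0∞) (a : A) : ℝ≥0∞ :=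
  ∑ o : O, P.trOBel b a o * P.val Tset (P.belStep b a o)

/-- A state is absorbing if once reached the system stays there forever. -/
def Absorbing (P : POMDP Q A O) (q : Q) : Prop :=
  ∀ a o q', P.tr q a o q' ≠ 0 → q' = q

/-- A state is observable if there is an observation received exactly when
entering this state. -/
def Observable (P : POMDP Q A O) (q : Q) : Prop :=
  ∃ o : O, ∀ p a o' q', P.tr p a o' q' ≠ 0 → (q' = q ↔ o' = o)

/-- An observable history is inside a partial function `(dom, act)` from a support
`S`: every action taken is prescribed by `act` at the current support, which stays
in `dom`. -/
def InsideFrom (P : POMDP Q A O) (dom : Set (Finset Q)) (act : Finset Q → Finset A) :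
    Finset Q → List (A × O) → Prop
  | _, [] => True
  | S, (a, o) :: h => S ∈ dom ∧ a ∈ act S ∧ InsideFrom P dom act (P.stepSet S a o) h

/-- A support end component (SEC): a partial function from nonempty belief supports
to nonempty sets of actions, closed under prescribed transitions and strongly
connected via prescribed histories. -/
structure SEC (P : POMDP Q A O) where
  dom : Set (Finset Q)
  act : Finset Q → Finset A
  dom_nonempty : ∀ S ∈ dom, S.Nonempty
  act_nonempty : ∀ S ∈ dom, (act S).Nonempty
  closed : ∀ S ∈ dom, ∀ a ∈ act S, ∀ o : O, (P.stepSet S a o).Nonempty → P.stepSet S a o ∈ dom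
  connected : ∀ S ∈ dom, ∀ S' ∈ dom,
      ∃ h : List (A × O), InsideFrom P dom act S h ∧ P.stepSetStar S h = S'

/-- `f` is contained in `f'`. -/
def SEC.Contained {P : POMDP Q A O} (f f' : SEC P) : Prop :=
  f.dom ⊆ f'.dom ∧ ∀ S ∈ f.dom, f.act S ⊆ f'.act S

/-- A maximal SEC: any SEC containing it coincides with it. -/
def SEC.Maximal {P : POMDP Q A O} (f : SEC P) : Prop :=
  ∀ f' : SEC P, f.Contained f' → f'.dom = f.dom ∧ ∀ S ∈ f.dom, f'.act S = f.act S

/-- `(f, S)`-indistinguishability of two states `q, q' ∈ S`: along every history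
inside `f` from `S`, the observation distributions from the (unique) successors of
`q` and `q'` agree for all prescribed actions. -/
def Indist (P : POMDP Q A O) (f : SEC P) (S : Finset Q) (q q' : Q) : Prop :=
  ∀ h : List (A × O), InsideFrom P f.dom f.act S h →
    ∀ a ∈ f.act (P.stepSetStar S h), ∀ o : O,
      ∀ x ∈ P.stepSetStar {q} h, ∀ y ∈ P.stepSetStar {q'} h,
        P.trO x a o = P.trO y a o

/-- A distinguishing SEC. -/
def SEC.Distinguishing {P : POMDP Q A O} (f : SEC P) : Prop :=
  ∃ S ∈ f.dom, ∃ q ∈ S, ∃ q' ∈ S, ¬ Indist P f S q q'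

/-- A non-distinguishing SEC. -/
def SEC.NonDistinguishing {P : POMDP Q A O} (f : SEC P) : Prop :=
  ∀ S ∈ f.dom, ∀ q ∈ S, ∀ q' ∈ S, Indist P f S q q'

/-- The `(f,S)`-indistinguishability class of `q` inside `S`. -/
noncomputable def classOf (P : POMDP Q A O) (f : SEC P) (S : Finset Q) (q : Q) : Finset Q :=
  S.filter fun q' => Indist P f S q q'

/-- `Reach_f(b)`: the set of beliefs reachable from `b` by histories inside `f`. -/
def reachBel (P : POMDP Q A O) (f : SEC P) (b : Q → ℝ≥0∞) : Set (Q → ℝ≥0∞) :=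
  {b' | ∃ h : List (A × O), InsideFrom P f.dom f.act (beliefSupp b) h ∧ P.belStepStar b h = b'}

/-- An observable run stays inside `f` from the support `S0`. -/
def RunInside (P : POMDP Q A O) (f : SEC P) (S0 : Finset Q) (ρ : ℕ → A × O) : Prop :=
  ∀ n : ℕ, InsideFrom P f.dom f.act S0 (runPrefix ρ n)

/-- The a-posteriori probability `X_q^n(ρ) = δ*(b, ρ|_n)(δ*(q, ρ|_n))` of having
started in `q`, given the first `n` action-observation pairs of `ρ`. -/
noncomputable def Xpost (P : POMDP Q A O) (b : Q → ℝ≥0∞) (q : Q) (ρ : ℕ → A × O)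
    (n : ℕ) : ℝ≥0∞ :=
  ∑ x ∈ P.stepSetStar {q} (runPrefix ρ n), P.belStepStar b (runPrefix ρ n) x

/-- A history `h = h' ++ [(a,o)]` distinguishes `q` and `q'`:
`T(o | δ*(q,h'), a) ≠ T(o | δ*(q',h'), a)`. -/
def HistDistinguishes (P : POMDP Q A O) (q q' : Q) (h : List (A × O)) : Prop :=
  ∃ (h' : List (A × O)) (ao : A × O), h = h' ++ [ao] ∧
    (∑ x ∈ P.stepSetStar {q} h', P.trO x ao.1 ao.2) ≠
      (∑ x ∈ P.stepSetStar {q'} h', P.trO x ao.1 ao.2)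

/-- The number of (nonempty) prefixes of `h` distinguishing `q` and `q'`. -/
noncomputable def distCount (P : POMDP Q A O) (q q' : Q) (h : List (A × O)) : ℕ :=
  ((Finset.range (h.length + 1)).filter fun i => P.HistDistinguishes q q' (h.take i)).card

/-- Probability `P_b^σ(Cyl(h))` of the cylinder of an observable history. -/
noncomputable def obsCylProb (P : POMDP Q A O) (b : Q → ℝ≥0∞) (σ : Strategy A O)
    (h : List (A × O)) : ℝ≥0∞ :=
  ∑' p : Q × List (A × O × Q), if obsOf p.2 = h then P.histProb b σ p.1 p.2 else 0

/-- Probability `P_b^σ(initial state is q ∧ Cyl(h))`. -/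
noncomputable def jointProb (P : POMDP Q A O) (b : Q → ℝ≥0∞) (σ : Strategy A O)
    (q : Q) (h : List (A × O)) : ℝ≥0∞ :=
  ∑' l : List (A × O × Q), if obsOf l = h then P.histProb b σ q l else 0

/-- `X_q^n` evaluated on the `F_n`-atom of the observable history `h`:
the conditional probability of having started in `q` given `Cyl(h)`. -/
noncomputable def condX (P : POMDP Q A O) (b : Q → ℝ≥0∞) (σ : Strategy A O)
    (q : Q) (h : List (A × O)) : ℝ≥0∞ :=
  P.jointProb b σ q h / P.obsCylProb b σ h

/-- Probability `P_b^σ(∃ prefix whose observable history satisfies E)`: the sum of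
cylinder probabilities over histories satisfying `E` for the first time. -/
noncomputable def eventProb (P : POMDP Q A O) (b : Q → ℝ≥0∞) (σ : Strategy A O)
    (E : List (A × O) → Prop) : ℝ≥0∞ :=
  ∑' p : Q × List (A × O × Q),
    if E (obsOf p.2) ∧ ∀ l' : List (A × O × Q), l' <+: p.2 → l' ≠ p.2 → ¬ E (obsOf l')
    then P.histProb b σ p.1 p.2 else 0

/-- The set of actions used by the uniform strategy of an SEC `f` after an
observable history (the prescribed actions if the current support has some,
all actions otherwise). -/
noncomputable def unifSupport (P : POMDP Q A O) (f : SEC P) (S0 : Finset Q)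
    (h : List (A × O)) : Finset A :=
  if (f.act (P.stepSetStar S0 h)).Nonempty then f.act (P.stepSetStar S0 h) else Finset.univ

theorem unifSupport_nonempty [Nonempty A] (P : POMDP Q A O) (f : SEC P) (S0 : Finset Q)
    (h : List (A × O)) : (P.unifSupport f S0 h).Nonempty := by
  unfold unifSupport
  split
  · assumption
  · exact Finset.univ_nonempty

/-- The uniform strategy `unif_f`: it tracks the current belief support and picks a
prescribed action uniformly at random. -/
noncomputable def unifStrat [Nonempty A] (P : POMDP Q A O) (f : SEC P) (S0 : Finset Q) :
    Strategy A O where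
  act h a := if a ∈ P.unifSupport f S0 h then ((P.unifSupport f S0 h).card : ℝ≥0∞)⁻¹ else 0
  act_sum_one := by
    intro h
    have hne := P.unifSupport_nonempty f S0 h
    rw [Finset.sum_ite_mem, Finset.univ_inter, Finset.sum_const, nsmul_eq_mul,
      ENNReal.mul_inv_cancel]
    · exact Nat.cast_ne_zero.mpr (Finset.card_ne_zero.mpr hne)
    · exact ENNReal.natCast_ne_top _

end POMDP

namespace POMDP

section Helpers

variable {Q A O : Type} [Fintype Q] [Fintype A] [Fintype O]

theorem stepSetStar_append (P : POMDP Q A O) (S : Finset Q) (h g : List (A × O)) :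
    P.stepSetStar S (h ++ g) = P.stepSetStar (P.stepSetStar S h) g := by
  induction h generalizing S with
  | nil => rfl
  | cons x h ih => obtain ⟨a, o⟩ := x; simp only [List.cons_append, stepSetStar]; exact ih _

theorem insideFrom_append (P : POMDP Q A O) (dom : Set (Finset Q)) (act : Finset Q → Finset A)
    (S : Finset Q) (h g : List (A × O)) :
    InsideFrom P dom act S (h ++ g) ↔
      InsideFrom P dom act S h ∧ InsideFrom P dom act (P.stepSetStar S h) g := by
  induction h generalizing S with
  | nil => simp [InsideFrom, stepSetStar]
  | cons x h ih =>
    obtain ⟨a, o⟩ := x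
    simp only [List.cons_append, stepSetStar, InsideFrom, ih]
    tauto

theorem stepSet_empty (P : POMDP Q A O) (a : A) (o : O) : P.stepSet ∅ a o = ∅ := by
  simp [stepSet]

theorem stepSetStar_empty (P : POMDP Q A O) (h : List (A × O)) : P.stepSetStar ∅ h = ∅ := by
  induction h with
  | nil => rfl
  | cons x h ih => obtain ⟨a, o⟩ := x; simp only [stepSetStar, stepSet_empty, ih]

theorem stepSetStar_union (P : POMDP Q A O) (S T : Finset Q) (h : List (A × O)) :
    P.stepSetStar (S ∪ T) h = P.stepSetStar S h ∪ P.stepSetStar T h := by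
  induction h generalizing S T with
  | nil => rfl
  | cons x h ih =>
    obtain ⟨a, o⟩ := x
    simp only [stepSetStar, ← ih]
    congr 1
    simp only [stepSet, Finset.union_biUnion]

theorem stepSetStar_mono (P : POMDP Q A O) {S T : Finset Q} (hST : S ⊆ T) (h : List (A × O)) :
    P.stepSetStar S h ⊆ P.stepSetStar T h := by
  have : T = S ∪ T := (Finset.union_eq_right.mpr hST).symm
  rw [this, stepSetStar_union]
  exact Finset.subset_union_left

theorem mem_stepSetStar (P : POMDP Q A O) (S : Finset Q) (h : List (A × O)) (y : Q) :
    y ∈ P.stepSetStar S h ↔ ∃ x ∈ S, y ∈ P.stepSetStar {x} h := by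
  induction S using Finset.induction_on with
  | empty => simp [stepSetStar_empty]
  | insert a s ha ih =>
    rw [Finset.insert_eq, stepSetStar_union, Finset.mem_union, ih]
    simp

theorem succs_card_le (P : POMDP Q A O) (hP : P.PostDet) (q : Q) (a : A) (o : O) :
    (P.succs q a o).card ≤ 1 := by
  rw [Finset.card_le_one]
  intro x hx y hy
  simp only [succs, Finset.mem_filter, Finset.mem_univ, true_and] at hx hy
  exact hP q a o x y hx hy

theorem stepSet_card_le (P : POMDP Q A O) (hP : P.PostDet) (S : Finset Q) (a : A) (o : O) :
    (P.stepSet S a o).card ≤ S.card := by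
  have := Finset.card_biUnion_le_card_mul S (fun q => P.succs q a o) 1
    (fun q _ => P.succs_card_le hP q a o)
  simpa [stepSet] using this

theorem stepSetStar_card_le (P : POMDP Q A O) (hP : P.PostDet) (S : Finset Q)
    (h : List (A × O)) : (P.stepSetStar S h).card ≤ S.card := by
  induction h generalizing S with
  | nil => exact le_rfl
  | cons x h ih =>
    obtain ⟨a, o⟩ := x
    exact (ih _).trans (P.stepSet_card_le hP S a o)

theorem SEC.star_mem {P : POMDP Q A O} (f : SEC P) (S : Finset Q) (hS : S ∈ f.dom)
    (h : List (A × O)) (hi : InsideFrom P f.dom f.act S h) (hne : (P.stepSetStar S h).Nonempty) :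
    P.stepSetStar S h ∈ f.dom := by
  induction h generalizing S with
  | nil => exact hS
  | cons x h ih =>
    obtain ⟨a, o⟩ := x
    simp only [stepSetStar, InsideFrom] at *
    refine ih _ (f.closed S hS a hi.2.1 o ?_) hi.2.2 hne
    by_contra hcon
    rw [Finset.not_nonempty_iff_eq_empty] at hcon
    rw [hcon, stepSetStar_empty] at hne
    exact Finset.not_nonempty_empty hne

theorem SEC.card_eq {P : POMDP Q A O} (hP : P.PostDet) (f : SEC P) (S T : Finset Q)
    (hS : S ∈ f.dom) (hT : T ∈ f.dom) : S.card = T.card := by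
  apply le_antisymm
  · obtain ⟨h, -, e⟩ := f.connected T hT S hS
    rw [← e]; exact P.stepSetStar_card_le hP T h
  · obtain ⟨h, -, e⟩ := f.connected S hS T hT
    rw [← e]; exact P.stepSetStar_card_le hP S h

/-- No state of the support dies along a possible history inside an SEC. -/
theorem SEC.alive {P : POMDP Q A O} (hP : P.PostDet) (f : SEC P) (S : Finset Q)
    (hS : S ∈ f.dom) (h : List (A × O)) (hi : InsideFrom P f.dom f.act S h)
    (hne : (P.stepSetStar S h).Nonempty) (x : Q) (hx : x ∈ S) :
    ∃ y, P.stepSetStar {x} h = {y} := by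
  have h1 : (P.stepSetStar {x} h).card ≤ 1 := by
    simpa using P.stepSetStar_card_le hP {x} h
  have hc := f.card_eq hP S _ hS (f.star_mem S hS h hi hne)
  have hu : S = {x} ∪ S.erase x := by
    rw [← Finset.insert_eq, Finset.insert_erase hx]
  have h2 : (P.stepSetStar S h).card ≤
      (P.stepSetStar {x} h).card + (P.stepSetStar (S.erase x) h).card := by
    conv_lhs => rw [hu, stepSetStar_union]
    exact Finset.card_union_le _ _
  have h3 := P.stepSetStar_card_le hP (S.erase x) h
  have h4 := Finset.card_erase_add_one hx
  exact Finset.card_eq_one.mp (by omega)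

/-- Repeating a history. -/
def repHist (u : List (A × O)) : ℕ → List (A × O)
  | 0 => []
  | k + 1 => u ++ repHist u k

theorem rep_star (P : POMDP Q A O) (f : SEC P) (S : Finset Q)
    (u : List (A × O)) (hi : InsideFrom P f.dom f.act S u) (hu : P.stepSetStar S u = S) (k : ℕ) :
    InsideFrom P f.dom f.act S (repHist u k) ∧ P.stepSetStar S (repHist u k) = S := by
  induction k with
  | zero => exact ⟨trivial, rfl⟩
  | succ k ih =>
    simp only [repHist, insideFrom_append, stepSetStar_append, hu]
    exact ⟨⟨hi, ih.1⟩, ih.2⟩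

/-- A loop on a support can be completed so that every state returns to itself. -/
theorem loop_id (P : POMDP Q A O) (hP : P.PostDet) (f : SEC P) (S : Finset Q) (hS : S ∈ f.dom)
    (u : List (A × O)) (hi : InsideFrom P f.dom f.act S u) (hu : P.stepSetStar S u = S) :
    ∃ k : ℕ, ∀ x ∈ S, P.stepSetStar {x} (repHist u (k + 1)) = {x} := by
  have hne : (P.stepSetStar S u).Nonempty := by rw [hu]; exact f.dom_nonempty S hS
  have hal := f.alive hP S hS u hi hne
  choose! π hπ using hal
  have hπS : ∀ x ∈ S, π x ∈ S := by
    intro x hx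
    rw [← hu, mem_stepSetStar]
    exact ⟨x, hx, by rw [hπ x hx]; simp⟩
  let p : S → S := fun x => ⟨π x, hπS x x.2⟩
  have hsurj : Function.Surjective p := by
    rintro ⟨y, hy⟩
    have hy' := hy
    rw [← hu, mem_stepSetStar] at hy'
    obtain ⟨x, hx, hxy⟩ := hy'
    rw [hπ x hx, Finset.mem_singleton] at hxy
    exact ⟨⟨x, hx⟩, Subtype.ext hxy.symm⟩
  have hbij : Function.Bijective p := Finite.surjective_iff_bijective.mp hsurj
  let e : Equiv.Perm S := Equiv.ofBijective p hbij
  have hstep : ∀ (k : ℕ) (x : S), P.stepSetStar {(x : Q)} (repHist u k) = {(((e ^ k) x : S) : Q)} := by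
    intro k
    induction k with
    | zero => intro x; simp [repHist, stepSetStar]
    | succ k ih =>
      intro x
      rw [repHist, stepSetStar_append, hπ x x.2]
      have := ih (p x)
      rw [pow_succ, Equiv.Perm.mul_apply]
      exact this
  have hpos : 0 < orderOf e := orderOf_pos e
  refine ⟨orderOf e - 1, fun x hx => ?_⟩
  rw [Nat.sub_add_cancel hpos]
  have := hstep (orderOf e) ⟨x, hx⟩
  rw [pow_orderOf_eq_one] at this
  exact this

/-- Validity of a history. -/
def ValidH (P : POMDP Q A O) (f : SEC P) (S : Finset Q) (h : List (A × O)) : Prop :=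
  InsideFrom P f.dom f.act S h ∧ (P.stepSetStar S h).Nonempty

/-- After any valid history, one can return to the initial configuration. -/
theorem return_exists (P : POMDP Q A O) (hP : P.PostDet) (f : SEC P) (S : Finset Q)
    (hS : S ∈ f.dom) (h : List (A × O)) (hv : ValidH P f S h) :
    ∃ g, InsideFrom P f.dom f.act (P.stepSetStar S h) g ∧ P.stepSetStar S (h ++ g) = S ∧
      ∀ x ∈ S, P.stepSetStar {x} (h ++ g) = {x} := by
  obtain ⟨g0, hg0, hg0S⟩ := f.connected _ (f.star_mem S hS h hv.1 hv.2) S hS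
  have hu : P.stepSetStar S (h ++ g0) = S := by rw [stepSetStar_append, hg0S]
  have hi : InsideFrom P f.dom f.act S (h ++ g0) := by
    rw [insideFrom_append]; exact ⟨hv.1, hg0⟩
  obtain ⟨k, hk⟩ := loop_id P hP f S hS _ hi hu
  have hr := rep_star P f S _ hi hu k
  have happ : h ++ (g0 ++ repHist (h ++ g0) k) = repHist (h ++ g0) (k + 1) := by
    simp [repHist]
  refine ⟨g0 ++ repHist (h ++ g0) k, ?_, ?_, ?_⟩
  · rw [insideFrom_append, hg0S]; exact ⟨hg0, hr.1⟩
  · rw [← List.append_assoc, stepSetStar_append, hu, hr.2]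
  · rw [happ]; exact hk

/-- Continuation `g` from configuration `t` which ends with a distinguishing step. -/
def GoodCont (P : POMDP Q A O) (f : SEC P) (t : Finset Q × Finset Q × Finset Q)
    (g : List (A × O)) : Prop :=
  InsideFrom P f.dom f.act t.1 g ∧ (P.stepSetStar t.1 g).Nonempty ∧
    ∃ (g' : List (A × O)) (ao : A × O), g = g' ++ [ao] ∧
      (∑ x ∈ P.stepSetStar t.2.1 g', P.trO x ao.1 ao.2) ≠
        (∑ x ∈ P.stepSetStar t.2.2 g', P.trO x ao.1 ao.2)

theorem stepSet_nonempty_of_trO (P : POMDP Q A O) (S : Finset Q) (x : Q) (hx : x ∈ S) (a : A)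
    (o : O) (h : P.trO x a o ≠ 0) : (P.stepSet S a o).Nonempty := by
  obtain ⟨y, -, hy⟩ := Finset.exists_ne_zero_of_sum_ne_zero h
  exact ⟨y, by simp only [stepSet, Finset.mem_biUnion]; exact ⟨x, hx, by simp [succs, hy]⟩⟩

theorem good_exists (P : POMDP Q A O) (hP : P.PostDet) (f : SEC P) (S : Finset Q)
    (hS : S ∈ f.dom) (q q' : Q) (hq : q ∈ S) (hq' : q' ∈ S) (hdist : ¬ Indist P f S q q')
    (h : List (A × O)) (hv : ValidH P f S h) :
    ∃ g, GoodCont P f (P.stepSetStar S h, P.stepSetStar {q} h, P.stepSetStar {q'} h) g := by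
  obtain ⟨r, hri, hrS, hrx⟩ := return_exists P hP f S hS h hv
  unfold Indist at hdist
  push Not at hdist
  obtain ⟨h0, hi0, a, ha, o, x, hx, y, hy, hxy⟩ := hdist
  have hsub : ∀ z ∈ S, P.stepSetStar {z} h0 ⊆ P.stepSetStar S h0 := fun z hz =>
    P.stepSetStar_mono (by simpa using hz) h0
  have hne0 : (P.stepSetStar S h0).Nonempty := ⟨x, hsub q hq hx⟩
  have hd0 := f.star_mem S hS h0 hi0 hne0
  have hne1 : (P.stepSet (P.stepSetStar S h0) a o).Nonempty := by
    by_cases hx0 : P.trO x a o = 0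
    · exact P.stepSet_nonempty_of_trO _ y (hsub q' hq' hy) a o (fun hy0 => hxy (hx0.trans hy0.symm))
    · exact P.stepSet_nonempty_of_trO _ x (hsub q hq hx) a o hx0
  have hqx : P.stepSetStar {q} h0 = {x} := by
    obtain ⟨z, hz⟩ := f.alive hP S hS h0 hi0 hne0 q hq
    rw [hz, Finset.mem_singleton] at hx; rw [hz, hx]
  have hqy : P.stepSetStar {q'} h0 = {y} := by
    obtain ⟨z, hz⟩ := f.alive hP S hS h0 hi0 hne0 q' hq'
    rw [hz, Finset.mem_singleton] at hy; rw [hz, hy]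
  have hrS' : P.stepSetStar (P.stepSetStar S h) r = S := by rw [← stepSetStar_append, hrS]
  refine ⟨(r ++ h0) ++ [(a, o)], ?_, ?_, r ++ h0, (a, o), rfl, ?_⟩
  · simp only [insideFrom_append, stepSetStar_append, hrS', InsideFrom]
    exact ⟨⟨hri, hi0⟩, hd0, ha, trivial⟩
  · simp only [stepSetStar_append, hrS']
    exact hne1
  · simp only
    rw [← stepSetStar_append, ← stepSetStar_append, ← List.append_assoc,
      stepSetStar_append P {q} (h ++ r), stepSetStar_append P {q'} (h ++ r), hrx q hq, hrx q' hq',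
      hqx, hqy, Finset.sum_singleton, Finset.sum_singleton]
    exact hxy

theorem distCount_append (P : POMDP Q A O) (q q' : Q) (h g : List (A × O)) (hg : g ≠ [])
    (hd : P.HistDistinguishes q q' (h ++ g)) :
    P.distCount q q' h + 1 ≤ P.distCount q q' (h ++ g) := by
  unfold distCount
  have hl : 0 < g.length := List.length_pos_iff.mpr hg
  have hnot : (h ++ g).length ∉ (Finset.range (h.length + 1)).filter
      fun i => P.HistDistinguishes q q' (h.take i) := by
    simp only [Finset.mem_filter, Finset.mem_range, List.length_append]
    omega
  rw [← Finset.card_insert_of_notMem hnot]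
  apply Finset.card_le_card
  intro i hi
  rw [Finset.mem_insert] at hi
  rcases hi with rfl | hi
  · simp only [Finset.mem_filter, Finset.mem_range]
    exact ⟨by omega, by rw [List.take_length]; exact hd⟩
  · simp only [Finset.mem_filter, Finset.mem_range] at hi ⊢
    refine ⟨by rw [List.length_append]; omega, ?_⟩
    rw [List.take_append_of_le_length (by omega)]
    exact hi.2

/-- Uniform bound for continuations with one more distinguishing step. -/
theorem uniform_one (P : POMDP Q A O) (hP : P.PostDet) (f : SEC P) (S : Finset Q)
    (hS : S ∈ f.dom) (q q' : Q) (hq : q ∈ S) (hq' : q' ∈ S) (hdist : ¬ Indist P f S q q') :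
    ∃ N : ℕ, ∀ h, ValidH P f S h → ∃ g : List (A × O), g.length ≤ N ∧ ValidH P f S (h ++ g) ∧
      P.distCount q q' h + 1 ≤ P.distCount q q' (h ++ g) := by
  have key : ∀ t : Finset Q × Finset Q × Finset Q, ∃ g : List (A × O),
      (∃ g, GoodCont P f t g) → GoodCont P f t g := by
    intro t
    by_cases ht : ∃ g, GoodCont P f t g
    · obtain ⟨g, hg⟩ := ht; exact ⟨g, fun _ => hg⟩
    · exact ⟨[], fun h => absurd h ht⟩
  choose G hG using key
  refine ⟨Finset.univ.sup fun t => (G t).length, fun h hv => ?_⟩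
  have hg := hG _ (good_exists P hP f S hS q q' hq hq' hdist h hv)
  set t := (P.stepSetStar S h, P.stepSetStar {q} h, P.stepSetStar {q'} h) with ht
  obtain ⟨h1, h2, g', ao, h3, h4⟩ := hg
  refine ⟨G t, Finset.le_sup (f := fun t => (G t).length) (Finset.mem_univ t), ⟨?_, ?_⟩, ?_⟩
  · rw [insideFrom_append]; exact ⟨hv.1, h1⟩
  · rw [stepSetStar_append]; exact h2
  · refine distCount_append P q q' h _ (by rw [h3]; simp) ⟨h ++ g', ao, by rw [h3]; simp, ?_⟩
    rw [stepSetStar_append, stepSetStar_append]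
    exact h4

theorem uniform_many (P : POMDP Q A O) (hP : P.PostDet) (f : SEC P) (S : Finset Q)
    (hS : S ∈ f.dom) (q q' : Q) (hq : q ∈ S) (hq' : q' ∈ S) (hdist : ¬ Indist P f S q q')
    (m : ℕ) :
    ∃ N : ℕ, ∀ h, ValidH P f S h → ∃ g : List (A × O), g.length ≤ N ∧ ValidH P f S (h ++ g) ∧
      m ≤ P.distCount q q' (h ++ g) := by
  obtain ⟨N, hN⟩ := uniform_one P hP f S hS q q' hq hq' hdist
  induction m with
  | zero => exact ⟨0, fun h hv => ⟨[], by simp, by simpa using hv, by simp⟩⟩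
  | succ m ih =>
    obtain ⟨M, hM⟩ := ih
    refine ⟨M + N, fun h hv => ?_⟩
    obtain ⟨g, hg1, hg2, hg3⟩ := hM h hv
    obtain ⟨k, hk1, hk2, hk3⟩ := hN _ hg2
    refine ⟨g ++ k, by rw [List.length_append]; omega, ?_, ?_⟩
    · rw [← List.append_assoc]; exact hk2
    · rw [← List.append_assoc]; omega

/-- Probability of hitting `E` within `n` steps. -/
noncomputable def hitP (P : POMDP Q A O) (σ : Strategy A O) (E : List (A × O) → Prop) :
    ℕ → List (A × O) → Q → ℝ≥0∞
  | 0, h, _ => if E h then 1 else 0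
  | n + 1, h, x => if E h then 1 else
      ∑ c : A × O × Q, σ.act h c.1 * P.tr x c.1 c.2.1 c.2.2 *
        hitP P σ E n (h ++ [(c.1, c.2.1)]) c.2.2

/-- Probability of avoiding `E` for `n` steps. -/
noncomputable def avoidP (P : POMDP Q A O) (σ : Strategy A O) (E : List (A × O) → Prop) :
    ℕ → List (A × O) → Q → ℝ≥0∞
  | 0, h, _ => if E h then 0 else 1
  | n + 1, h, x => if E h then 0 else
      ∑ c : A × O × Q, σ.act h c.1 * P.tr x c.1 c.2.1 c.2.2 *
        avoidP P σ E n (h ++ [(c.1, c.2.1)]) c.2.2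

theorem step_sum_one (P : POMDP Q A O) (σ : Strategy A O) (h : List (A × O)) (x : Q) :
    ∑ c : A × O × Q, σ.act h c.1 * P.tr x c.1 c.2.1 c.2.2 = 1 := by
  simp only [Fintype.sum_prod_type, ← Finset.mul_sum, P.tr_sum_one, mul_one, σ.act_sum_one]

theorem hit_add_avoid (P : POMDP Q A O) (σ : Strategy A O) (E : List (A × O) → Prop) (n : ℕ)
    (h : List (A × O)) (x : Q) : hitP P σ E n h x + avoidP P σ E n h x = 1 := by
  induction n generalizing h x with
  | zero => simp only [hitP, avoidP]; split <;> simp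
  | succ n ih =>
    simp only [hitP, avoidP]
    split
    · simp
    · simp only [← Finset.sum_add_distrib, ← mul_add, ih, mul_one, step_sum_one]

/-- First-hit predicate for continuations. -/
def FirstE (E : List (A × O) → Prop) (hist : List (A × O)) (l : List (A × O × Q)) : Prop :=
  E (hist ++ obsOf l) ∧
    ∀ l' : List (A × O × Q), l' <+: l → l' ≠ l → ¬ E (hist ++ obsOf l')

theorem firstE_nil (E : List (A × O) → Prop) (hist : List (A × O)) :
    FirstE (Q := Q) E hist [] ↔ E hist := by
  constructor
  · intro h; simpa [obsOf] using h.1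
  · intro h
    refine ⟨by simpa [obsOf] using h, fun l' hl hne => ?_⟩
    exact absurd (List.prefix_nil.mp hl) hne

theorem firstE_cons (E : List (A × O) → Prop) (hist : List (A × O)) (c : A × O × Q)
    (t : List (A × O × Q)) :
    FirstE E hist (c :: t) ↔ ¬ E hist ∧ FirstE E (hist ++ [(c.1, c.2.1)]) t := by
  have hobs : ∀ s : List (A × O × Q),
      hist ++ obsOf (c :: s) = hist ++ [(c.1, c.2.1)] ++ obsOf s := by
    intro s; simp [obsOf]
  constructor
  · rintro ⟨h1, h2⟩
    refine ⟨?_, ?_, ?_⟩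
    · have := h2 [] (by simp) (by simp)
      simpa [obsOf] using this
    · rw [← hobs]; exact h1
    · intro l' hl hne
      rw [← hobs]
      exact h2 (c :: l') (by simpa using hl) (by simpa using hne)
  · rintro ⟨h1, h2, h3⟩
    refine ⟨by rw [hobs]; exact h2, ?_⟩
    intro l' hl hne
    cases l' with
    | nil => simpa [obsOf] using h1
    | cons d s =>
      obtain ⟨rfl, hs⟩ := List.cons_prefix_cons.mp hl
      rw [hobs]
      exact h3 s hs (by simpa using hne)

theorem tsum_list {α : Type} [Fintype α] (F : List α → ℝ≥0∞) :
    ∑' l, F l = F [] + ∑ c : α, ∑' t, F (c :: t) := by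
  let e : Unit ⊕ (α × List α) ≃ List α :=
    { toFun := fun o => match o with
        | Sum.inl _ => []
        | Sum.inr p => p.1 :: p.2
      invFun := fun l => match l with
        | [] => Sum.inl ()
        | a :: t => Sum.inr (a, t)
      left_inv := by intro o; cases o <;> rfl
      right_inv := by intro l; cases l <;> rfl }
  rw [← e.tsum_eq, Summable.tsum_sum ENNReal.summable ENNReal.summable, ENNReal.tsum_prod',
    tsum_fintype, tsum_fintype, Fintype.sum_unique]
  rfl

theorem hit_eq_tsum (P : POMDP Q A O) (σ : Strategy A O) (E : List (A × O) → Prop) (n : ℕ)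
    (h : List (A × O)) (x : Q) :
    hitP P σ E n h x = ∑' l : List (A × O × Q),
      if l.length ≤ n ∧ FirstE E h l then P.runProbAux σ h x l else 0 := by
  induction n generalizing h x with
  | zero =>
    rw [tsum_list]
    simp [firstE_nil, hitP, runProbAux]
  | succ n ih =>
    rw [tsum_list]
    by_cases hE : E h
    · simp [firstE_nil, firstE_cons, hitP, runProbAux, hE]
    · simp only [hitP, hE, if_false, firstE_nil, firstE_cons, and_false, zero_add, not_false_eq_true,
        true_and, ih, List.length_cons, add_le_add_iff_right]
      refine Finset.sum_congr rfl fun c _ => ?_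
      rw [← ENNReal.tsum_mul_left]
      refine tsum_congr fun t => ?_
      obtain ⟨a, o, y⟩ := c
      simp only [runProbAux, mul_ite, mul_zero]

/-- Total first-hit probability. -/
noncomputable def totP (P : POMDP Q A O) (σ : Strategy A O) (E : List (A × O) → Prop) (x : Q) :
    ℝ≥0∞ :=
  ∑' l : List (A × O × Q), if FirstE E [] l then P.runProbAux σ [] x l else 0

theorem hit_le_tot (P : POMDP Q A O) (σ : Strategy A O) (E : List (A × O) → Prop) (n : ℕ)
    (x : Q) : hitP P σ E n [] x ≤ totP P σ E x := by
  rw [hit_eq_tsum]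
  refine ENNReal.tsum_le_tsum fun l => ?_
  by_cases h : FirstE E [] l
  · simp only [h, and_true, if_true]; split <;> simp
  · simp [h]

theorem tot_le_one (P : POMDP Q A O) (σ : Strategy A O) (E : List (A × O) → Prop) (x : Q) :
    totP P σ E x ≤ 1 := by
  unfold totP
  rw [ENNReal.tsum_eq_iSup_sum]
  refine iSup_le fun s => ?_
  let n := s.sup List.length
  calc _ ≤ ∑ l ∈ s, if l.length ≤ n ∧ FirstE E [] l then P.runProbAux σ [] x l else 0 := by
        refine Finset.sum_le_sum fun l hl => ?_
        have : l.length ≤ n := Finset.le_sup (f := List.length) hl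
        simp [this]
    _ ≤ hitP P σ E n [] x := by rw [hit_eq_tsum]; exact ENNReal.sum_le_tsum s
    _ ≤ 1 := by rw [← hit_add_avoid P σ E n [] x]; exact le_self_add

theorem eventProb_eq (P : POMDP Q A O) (b : Q → ℝ≥0∞) (σ : Strategy A O)
    (E : List (A × O) → Prop) : P.eventProb b σ E = ∑ x, b x * totP P σ E x := by
  unfold eventProb totP
  rw [ENNReal.tsum_prod', tsum_fintype]
  refine Finset.sum_congr rfl fun x _ => ?_
  rw [← ENNReal.tsum_mul_left]
  refine tsum_congr fun l => ?_
  by_cases hF : FirstE E [] l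
  · rw [if_pos hF, if_pos (by simpa only [FirstE, List.nil_append] using hF)]
    rfl
  · rw [if_neg hF, if_neg (by simpa only [FirstE, List.nil_append] using hF), mul_zero]

theorem exists_tau (P : POMDP Q A O) : ∃ τ : ℝ≥0∞, 0 < τ ∧ τ ≤ 1 ∧
    ∀ x a o y, P.tr x a o y ≠ 0 → τ ≤ P.tr x a o y := by
  let F : Q × A × O × Q → ℝ≥0∞ := fun c =>
    if P.tr c.1 c.2.1 c.2.2.1 c.2.2.2 = 0 then 1 else P.tr c.1 c.2.1 c.2.2.1 c.2.2.2
  refine ⟨min 1 (Finset.univ.inf F), ?_, min_le_left _ _, ?_⟩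
  · rw [lt_min_iff]
    refine ⟨one_pos, ?_⟩
    rw [Finset.lt_inf_iff (by simp)]
    intro c _
    simp only [F]
    split
    · exact one_pos
    · exact pos_iff_ne_zero.mpr ‹_›
  · intro x a o y hne
    refine (min_le_right _ _).trans ((Finset.inf_le (Finset.mem_univ (x, a, o, y))).trans ?_)
    simp [F, hne]

section Unif
variable [Nonempty A]

theorem valid_step (P : POMDP Q A O) (f : SEC P) (S : Finset Q) (hS : S ∈ f.dom)
    (h : List (A × O)) (hv : ValidH P f S h) (x : Q) (hx : x ∈ P.stepSetStar S h)
    (a : A) (o : O) (y : Q) (hσ : (P.unifStrat f S).act h a ≠ 0) (ht : P.tr x a o y ≠ 0) :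
    ValidH P f S (h ++ [(a, o)]) ∧ y ∈ P.stepSetStar S (h ++ [(a, o)]) := by
  have hd := f.star_mem S hS h hv.1 hv.2
  have ha : a ∈ f.act (P.stepSetStar S h) := by
    have h1 : a ∈ P.unifSupport f S h := by
      by_contra hc; exact hσ (by simp [unifStrat, hc])
    unfold unifSupport at h1
    rwa [if_pos (f.act_nonempty _ hd)] at h1
  have hy : y ∈ P.stepSetStar S (h ++ [(a, o)]) := by
    rw [stepSetStar_append]
    simp only [stepSetStar, stepSet, Finset.mem_biUnion]
    exact ⟨x, hx, by simp [succs, ht]⟩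
  refine ⟨⟨?_, ⟨y, hy⟩⟩, hy⟩
  rw [insideFrom_append]
  exact ⟨hv.1, hd, ha, trivial⟩

theorem act_ge (P : POMDP Q A O) (f : SEC P) (S : Finset Q) (h : List (A × O)) (a : A)
    (hd : P.stepSetStar S h ∈ f.dom) (ha : a ∈ f.act (P.stepSetStar S h)) :
    (Fintype.card A : ℝ≥0∞)⁻¹ ≤ (P.unifStrat f S).act h a := by
  have h1 : a ∈ P.unifSupport f S h := by
    unfold unifSupport
    rwa [if_pos (f.act_nonempty _ hd)]
  simp only [unifStrat, h1, if_true]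
  rw [ENNReal.inv_le_inv]
  exact_mod_cast Finset.card_le_univ _

theorem hit_ge (P : POMDP Q A O) (hP : P.PostDet) (f : SEC P) (S : Finset Q) (hS : S ∈ f.dom)
    (E : List (A × O) → Prop) (c : ℝ≥0∞) (hc1 : c ≤ 1)
    (hc : ∀ h x a o y, P.stepSetStar S h ∈ f.dom → a ∈ f.act (P.stepSetStar S h) →
      P.tr x a o y ≠ 0 → c ≤ (P.unifStrat f S).act h a * P.tr x a o y)
    (g : List (A × O)) : ∀ (N : ℕ) (h : List (A × O)) (x : Q), g.length ≤ N →
      ValidH P f S h → x ∈ P.stepSetStar S h → ValidH P f S (h ++ g) → E (h ++ g) →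
      c ^ N ≤ hitP P (P.unifStrat f S) E N h x := by
  induction g with
  | nil =>
    intro N h x _ _ _ _ hE
    rw [List.append_nil] at hE
    have : hitP P (P.unifStrat f S) E N h x = 1 := by cases N <;> simp [hitP, hE]
    rw [this]
    exact pow_le_one' hc1 N
  | cons ao g ih =>
    intro N h x hN hv hx hv' hE
    obtain ⟨a, o⟩ := ao
    cases N with
    | zero => simp at hN
    | succ N =>
      simp only [List.length_cons, add_le_add_iff_right] at hN
      simp only [hitP]
      split
      · exact pow_le_one' hc1 _
      · have hd := f.star_mem S hS h hv.1 hv.2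
        have happ : h ++ (a, o) :: g = (h ++ [(a, o)]) ++ g := by simp
        rw [happ] at hv' hE
        have hin := hv'.1
        rw [insideFrom_append] at hin
        have hne : (P.stepSetStar S (h ++ [(a, o)])).Nonempty := by
          by_contra hcon
          rw [Finset.not_nonempty_iff_eq_empty] at hcon
          have := hv'.2
          rw [stepSetStar_append, hcon, stepSetStar_empty] at this
          exact Finset.not_nonempty_empty this
        have hv1 : ValidH P f S (h ++ [(a, o)]) := ⟨hin.1, hne⟩
        have hin1 := hin.1
        rw [insideFrom_append] at hin1
        have ha : a ∈ f.act (P.stepSetStar S h) := hin1.2.2.1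
        rw [stepSetStar_append] at hne
        obtain ⟨y, hy⟩ := f.alive hP _ hd [(a, o)] hin1.2 hne x hx
        have hyt : P.tr x a o y ≠ 0 := by
          have : y ∈ P.stepSetStar {x} [(a, o)] := by rw [hy]; simp
          simpa [stepSetStar, stepSet, succs] using this
        have hyS : y ∈ P.stepSetStar S (h ++ [(a, o)]) := by
          rw [stepSetStar_append, mem_stepSetStar]
          exact ⟨x, hx, by rw [hy]; simp⟩
        have hrec := ih N (h ++ [(a, o)]) y hN hv1 hyS hv' hE
        refine le_trans ?_ (Finset.single_le_sum (f := fun c : A × O × Q =>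
          (P.unifStrat f S).act h c.1 * P.tr x c.1 c.2.1 c.2.2 *
            hitP P (P.unifStrat f S) E N (h ++ [(c.1, c.2.1)]) c.2.2)
          (fun _ _ => zero_le) (Finset.mem_univ (a, o, y)))
        rw [pow_succ, mul_comm]
        exact mul_le_mul' (hc h x a o y hd ha hyt) hrec

theorem avoid_mul (P : POMDP Q A O) (f : SEC P) (S : Finset Q) (hS : S ∈ f.dom)
    (E : List (A × O) → Prop) (N : ℕ) (B : ℝ≥0∞)
    (hB : ∀ h x, ValidH P f S h → x ∈ P.stepSetStar S h →
      avoidP P (P.unifStrat f S) E N h x ≤ B) (n : ℕ) :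
    ∀ h x, ValidH P f S h → x ∈ P.stepSetStar S h →
      avoidP P (P.unifStrat f S) E (n + N) h x ≤ avoidP P (P.unifStrat f S) E n h x * B := by
  induction n with
  | zero =>
    intro h x hv hx
    rw [zero_add]
    by_cases hE : E h
    · have : avoidP P (P.unifStrat f S) E N h x = 0 := by cases N <;> simp [avoidP, hE]
      rw [this]; exact zero_le
    · simpa [avoidP, hE] using hB h x hv hx
  | succ n ih =>
    intro h x hv hx
    rw [show n + 1 + N = (n + N) + 1 by omega]
    simp only [avoidP]
    split
    · simp
    · rw [Finset.sum_mul]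
      refine Finset.sum_le_sum fun c _ => ?_
      by_cases h0 : (P.unifStrat f S).act h c.1 * P.tr x c.1 c.2.1 c.2.2 = 0
      · simp [h0]
      · obtain ⟨h1, h2⟩ := mul_ne_zero_iff.mp h0
        obtain ⟨hv', hy⟩ := valid_step P f S hS h hv x hx _ _ _ h1 h2
        rw [mul_assoc _ (avoidP P (P.unifStrat f S) E n _ _) B]
        exact mul_le_mul' le_rfl (ih _ _ hv' hy)

theorem avoid_pow (P : POMDP Q A O) (f : SEC P) (S : Finset Q) (hS : S ∈ f.dom)
    (E : List (A × O) → Prop) (N : ℕ) (B : ℝ≥0∞)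
    (hB : ∀ h x, ValidH P f S h → x ∈ P.stepSetStar S h →
      avoidP P (P.unifStrat f S) E N h x ≤ B) (k : ℕ) :
    ∀ h x, ValidH P f S h → x ∈ P.stepSetStar S h →
      avoidP P (P.unifStrat f S) E (k * N) h x ≤ B ^ k := by
  induction k with
  | zero =>
    intro h x _ _
    rw [pow_zero, ← hit_add_avoid P (P.unifStrat f S) E (0 * N) h x]
    exact le_add_self
  | succ k ih =>
    intro h x hv hx
    rw [Nat.succ_mul, pow_succ]
    refine (avoid_mul P f S hS E N B hB (k * N) h x hv hx).trans ?_
    gcongr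
    exact ih h x hv hx

end Unif

end Helpers

end POMDP

/-- In a posterior-deterministic POMDP, under the uniform
strategy `unif_f` of an SEC `f` started from `b`, for every pair of
`(f,S)`-distinguishable states `q, q' ∈ S = supp(b)`, almost every run
distinguishes `q` and `q'` infinitely often: for every `m`, with probability `1`
some prefix contains at least `m` distinguishing steps. -/
theorem stmt18 {Q A O : Type} [Fintype Q] [Fintype A] [Fintype O] [Nonempty A]
    (P : POMDP Q A O) (hP : P.PostDet)
    (f : POMDP.SEC P)
    (b : Q → ℝ≥0∞) (hb : (∑ q : Q, b q) = 1) (hS : beliefSupp b ∈ f.dom)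
    (q q' : Q) (hq : q ∈ beliefSupp b) (hq' : q' ∈ beliefSupp b)
    (hdist : ¬ POMDP.Indist P f (beliefSupp b) q q') :
    ∀ m : ℕ, P.eventProb b (P.unifStrat f (beliefSupp b))
      (fun h => m ≤ P.distCount q q' h) = 1 := by
  intro m
  set S := beliefSupp b with hSdef
  set σ := P.unifStrat f S
  set E : List (A × O) → Prop := fun h => m ≤ P.distCount q q' h with hE
  obtain ⟨N, hN⟩ := POMDP.uniform_many P hP f S hS q q' hq hq' hdist m
  obtain ⟨τ, hτ0, hτ1, hτ⟩ := P.exists_tau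
  set c : ℝ≥0∞ := (Fintype.card A : ℝ≥0∞)⁻¹ * τ with hcdef
  have hcard : (1 : ℝ≥0∞) ≤ Fintype.card A := by
    exact_mod_cast Fintype.card_pos
  have hc1 : c ≤ 1 := mul_le_one' (ENNReal.inv_le_one.mpr hcard) hτ1
  have hc0 : c ≠ 0 := mul_ne_zero (ENNReal.inv_ne_zero.mpr (ENNReal.natCast_ne_top _)) hτ0.ne'
  have hc : ∀ h x a o y, P.stepSetStar S h ∈ f.dom → a ∈ f.act (P.stepSetStar S h) →
      P.tr x a o y ≠ 0 → c ≤ σ.act h a * P.tr x a o y := by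
    intro h x a o y hd ha ht
    exact mul_le_mul' (P.act_ge f S h a hd ha) (hτ x a o y ht)
  have hB : ∀ h x, POMDP.ValidH P f S h → x ∈ P.stepSetStar S h →
      POMDP.avoidP P σ E N h x ≤ 1 - c ^ N := by
    intro h x hv hx
    obtain ⟨g, hg1, hg2, hg3⟩ := hN h hv
    have h1 := POMDP.hit_ge P hP f S hS E c hc1 hc g N h x hg1 hv hx hg2 hg3
    have h2 := POMDP.hit_add_avoid P σ E N h x
    refine ENNReal.le_sub_of_add_le_left (ENNReal.pow_ne_top (ne_top_of_le_ne_top ENNReal.one_ne_top hc1)) ?_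
    rw [← h2]
    gcongr
  have hlt : 1 - c ^ N < 1 :=
    ENNReal.sub_lt_self ENNReal.one_ne_top one_ne_zero (pow_ne_zero N hc0)
  have hlim := ENNReal.tendsto_pow_atTop_nhds_zero_of_lt_one hlt
  have htot : ∀ x ∈ S, POMDP.totP P σ E x = 1 := by
    intro x hx
    refine le_antisymm (P.tot_le_one σ E x) ?_
    have hlim2 : Tendsto (fun k : ℕ => POMDP.totP P σ E x + (1 - c ^ N) ^ k) atTop
        (𝓝 (POMDP.totP P σ E x + 0)) := tendsto_const_nhds.add hlim
    rw [add_zero] at hlim2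
    refine ge_of_tendsto' hlim2 fun k => ?_
    have hv : POMDP.ValidH P f S [] := ⟨trivial, ⟨x, hx⟩⟩
    refine (POMDP.hit_add_avoid P σ E (k * N) [] x).symm.le.trans ?_
    exact add_le_add (P.hit_le_tot σ E (k * N) x)
      (POMDP.avoid_pow P f S hS E N _ hB k [] x hv hx)
  rw [POMDP.eventProb_eq, ← hb]
  refine Finset.sum_congr rfl fun x _ => ?_
  by_cases hx : b x = 0
  · simp [hx]
  · rw [htot x (by simp [hSdef, beliefSupp, hx]), mul_one]
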